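/- arXiv:1305.2636 — 9 statements merged into one kernel-verified Lean document; each statement's English description precedes it below -/
import Mathlib

section
/- Let T, Th, Thh : ℕ → ℕ satisfy T(1)=0, Th(1)=1, Thh(1)=3, and for all n ≥ 2: T(n)=T(⌈n/2⌉)+T(⌊n/2⌋)+2·Th(⌈n/2⌉)+2·Th(⌊n/2⌋)+1, Th(n)=T(⌈n/2⌉)+Th(⌊n/2⌋)+2·Th(⌈n/2⌉)+2·Thh(⌊n/2⌋)+1, Thh(n)=Th(⌈n/2⌉)+Th(⌊n/2⌋)+2·Thh(⌈n/2⌉)+2·Thh(⌊n/2⌋)+1. Then for every integer k ≥ 1, (T(2^k) : ℚ) = (89/45)·6^k − (20/9)·3^k − 1/5. -/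
theorem fsr_T_explicit (T Th Thh : ℕ → ℕ)
    (hT1 : T 1 = 0) (hTh1 : Th 1 = 1) (hThh1 : Thh 1 = 3)
    (hT : ∀ n : ℕ, 2 ≤ n →
      T n = T ((n + 1) / 2) + T (n / 2) + 2 * Th ((n + 1) / 2) + 2 * Th (n / 2) + 1)
    (hTh : ∀ n : ℕ, 2 ≤ n →
      Th n = T ((n + 1) / 2) + Th (n / 2) + 2 * Th ((n + 1) / 2) + 2 * Thh (n / 2) + 1)
    (hThh : ∀ n : ℕ, 2 ≤ n →
      Thh n = Th ((n + 1) / 2) + Th (n / 2) + 2 * Thh ((n + 1) / 2) + 2 * Thh (n / 2) + 1) :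
    ∀ k : ℕ, 1 ≤ k →
      (T (2 ^ k) : ℚ) = (89 / 45) * 6 ^ k - (20 / 9) * 3 ^ k - 1 / 5 := by
  have step : ∀ k : ℕ,
      T (2 ^ (k + 1)) = 2 * T (2 ^ k) + 4 * Th (2 ^ k) + 1 ∧
      Th (2 ^ (k + 1)) = T (2 ^ k) + 3 * Th (2 ^ k) + 2 * Thh (2 ^ k) + 1 ∧
      Thh (2 ^ (k + 1)) = 2 * Th (2 ^ k) + 4 * Thh (2 ^ k) + 1 := by
    intro k
    have hpos : 1 ≤ 2 ^ k := Nat.one_le_two_pow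
    have e : 2 ^ (k + 1) = 2 * 2 ^ k := by ring
    have h2 : 2 ≤ 2 ^ (k + 1) := by omega
    have e1 : (2 ^ (k + 1) + 1) / 2 = 2 ^ k := by omega
    have e2 : 2 ^ (k + 1) / 2 = 2 ^ k := by omega
    have a := hT _ h2
    have b := hTh _ h2
    have c := hThh _ h2
    rw [e1, e2] at a b c
    refine ⟨?_, ?_, ?_⟩ <;> omega
  have key : ∀ k : ℕ, 1 ≤ k →
      (T (2 ^ k) : ℚ) = (89 / 45) * 6 ^ k - (20 / 9) * 3 ^ k - 1 / 5 ∧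
      (Th (2 ^ k) : ℚ) = (89 / 45) * 6 ^ k - (5 / 9) * 3 ^ k - 1 / 5 ∧
      (Thh (2 ^ k) : ℚ) = (89 / 45) * 6 ^ k + (10 / 9) * 3 ^ k - 1 / 5 := by
    intro k hk
    induction k, hk using Nat.le_induction with
    | base =>
      obtain ⟨a, b, c⟩ := step 0
      rw [zero_add, pow_zero] at a b c
      rw [a, b, c, hT1, hTh1, hThh1]
      norm_num
    | succ k hk ih =>
      obtain ⟨a, b, c⟩ := step k
      obtain ⟨ia, ib, ic⟩ := ih
      rw [a, b, c]
      push_cast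
      rw [ia, ib, ic]
      refine ⟨?_, ?_, ?_⟩ <;> ring
  exact fun k hk => (key k hk).1
end

section
/- Let T, Th, Thh : ℕ → ℕ satisfy T(1)=0, Th(1)=1, Thh(1)=3, and for all n ≥ 2: T(n)=T(⌈n/2⌉)+T(⌊n/2⌋)+2·Th(⌈n/2⌉)+2·Th(⌊n/2⌋)+1, Th(n)=T(⌈n/2⌉)+Th(⌊n/2⌋)+2·Th(⌈n/2⌉)+2·Thh(⌊n/2⌋)+1, Thh(n)=Th(⌈n/2⌉)+Th(⌊n/2⌋)+2·Thh(⌈n/2⌉)+2·Thh(⌊n/2⌋)+1. Then for every integer k ≥ 1, (Th(2^k) : ℚ) = (89/45)·6^k − (5/9)·3^k − 1/5. -/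
theorem fsr_Th_explicit (T Th Thh : ℕ → ℕ)
    (hT1 : T 1 = 0) (hTh1 : Th 1 = 1) (hThh1 : Thh 1 = 3)
    (hT : ∀ n : ℕ, 2 ≤ n →
      T n = T ((n + 1) / 2) + T (n / 2) + 2 * Th ((n + 1) / 2) + 2 * Th (n / 2) + 1)
    (hTh : ∀ n : ℕ, 2 ≤ n →
      Th n = T ((n + 1) / 2) + Th (n / 2) + 2 * Th ((n + 1) / 2) + 2 * Thh (n / 2) + 1)
    (hThh : ∀ n : ℕ, 2 ≤ n →
      Thh n = Th ((n + 1) / 2) + Th (n / 2) + 2 * Thh ((n + 1) / 2) + 2 * Thh (n / 2) + 1) :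
    ∀ k : ℕ, 1 ≤ k →
      (Th (2 ^ k) : ℚ) = (89 / 45) * 6 ^ k - (5 / 9) * 3 ^ k - 1 / 5 := by
  have step : ∀ m : ℕ,
      T (2 ^ (m + 1)) = 2 * T (2 ^ m) + 4 * Th (2 ^ m) + 1 ∧
      Th (2 ^ (m + 1)) = T (2 ^ m) + 3 * Th (2 ^ m) + 2 * Thh (2 ^ m) + 1 ∧
      Thh (2 ^ (m + 1)) = 2 * Th (2 ^ m) + 4 * Thh (2 ^ m) + 1 := by
    intro m
    have hpos : 1 ≤ 2 ^ m := Nat.one_le_two_pow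
    have h2 : 2 ≤ 2 ^ (m + 1) := by rw [pow_succ]; omega
    have e1 : (2 ^ (m + 1) + 1) / 2 = 2 ^ m := by rw [pow_succ]; omega
    have e2 : 2 ^ (m + 1) / 2 = 2 ^ m := by rw [pow_succ]; omega
    have a := hT _ h2
    have b := hTh _ h2
    have c := hThh _ h2
    rw [e1, e2] at a b c
    refine ⟨?_, ?_, ?_⟩ <;> omega
  have key : ∀ k : ℕ, 1 ≤ k →
      (T (2 ^ k) : ℚ) = (89 / 45) * 6 ^ k - (20 / 9) * 3 ^ k - 1 / 5 ∧
      (Th (2 ^ k) : ℚ) = (89 / 45) * 6 ^ k - (5 / 9) * 3 ^ k - 1 / 5 ∧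
      (Thh (2 ^ k) : ℚ) = (89 / 45) * 6 ^ k + (10 / 9) * 3 ^ k - 1 / 5 := by
    intro k hk
    induction k, hk using Nat.le_induction with
    | base =>
      obtain ⟨a, b, c⟩ := step 0
      simp only [zero_add, pow_zero, hT1, hTh1, hThh1] at a b c
      rw [a, b, c]
      norm_num
    | succ m hm ih =>
      obtain ⟨ia, ib, ic⟩ := ih
      obtain ⟨a, b, c⟩ := step m
      rw [a, b, c]
      push_cast
      rw [ia, ib, ic]
      refine ⟨?_, ?_, ?_⟩ <;> ring
  exact fun k hk => (key k hk).2.1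
end

section
/- Let T, Th, Thh : ℕ → ℕ satisfy T(1)=0, Th(1)=1, Thh(1)=3, and for all n ≥ 2: T(n)=T(⌈n/2⌉)+T(⌊n/2⌋)+2·Th(⌈n/2⌉)+2·Th(⌊n/2⌋)+1, Th(n)=T(⌈n/2⌉)+Th(⌊n/2⌋)+2·Th(⌈n/2⌉)+2·Thh(⌊n/2⌋)+1, Thh(n)=Th(⌈n/2⌉)+Th(⌊n/2⌋)+2·Thh(⌈n/2⌉)+2·Thh(⌊n/2⌋)+1. Then for every integer k ≥ 1, (Thh(2^k) : ℚ) = (89/45)·6^k + (10/9)·3^k − 1/5. -/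
theorem fsr_Thh_explicit (T Th Thh : ℕ → ℕ)
    (hT1 : T 1 = 0) (hTh1 : Th 1 = 1) (hThh1 : Thh 1 = 3)
    (hT : ∀ n : ℕ, 2 ≤ n →
      T n = T ((n + 1) / 2) + T (n / 2) + 2 * Th ((n + 1) / 2) + 2 * Th (n / 2) + 1)
    (hTh : ∀ n : ℕ, 2 ≤ n →
      Th n = T ((n + 1) / 2) + Th (n / 2) + 2 * Th ((n + 1) / 2) + 2 * Thh (n / 2) + 1)
    (hThh : ∀ n : ℕ, 2 ≤ n →
      Thh n = Th ((n + 1) / 2) + Th (n / 2) + 2 * Thh ((n + 1) / 2) + 2 * Thh (n / 2) + 1) :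
    ∀ k : ℕ, 1 ≤ k →
      (Thh (2 ^ k) : ℚ) = (89 / 45) * 6 ^ k + (10 / 9) * 3 ^ k - 1 / 5 := by
  have key : ∀ k : ℕ,
      (T (2 ^ (k + 1)) : ℚ) = (89 / 45) * 6 ^ (k + 1) - (20 / 9) * 3 ^ (k + 1) - 1 / 5 ∧
      (Th (2 ^ (k + 1)) : ℚ) = (89 / 45) * 6 ^ (k + 1) - (5 / 9) * 3 ^ (k + 1) - 1 / 5 ∧
      (Thh (2 ^ (k + 1)) : ℚ) = (89 / 45) * 6 ^ (k + 1) + (10 / 9) * 3 ^ (k + 1) - 1 / 5 := by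
    intro k
    induction k with
    | zero =>
      have a := hT 2 le_rfl
      have b := hTh 2 le_rfl
      have c := hThh 2 le_rfl
      norm_num [hT1, hTh1, hThh1] at a b c
      norm_num [a, b, c]
    | succ k ih =>
      obtain ⟨h1, h2, h3⟩ := ih
      have hp : 0 < 2 ^ (k + 1) := by positivity
      have hs : 2 ^ (k + 1 + 1) = 2 * 2 ^ (k + 1) := by ring
      have e1 : (2 ^ (k + 1 + 1) + 1) / 2 = 2 ^ (k + 1) := by omega
      have e2 : 2 ^ (k + 1 + 1) / 2 = 2 ^ (k + 1) := by omega
      have hn : 2 ≤ 2 ^ (k + 1 + 1) := by omega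
      have a := hT _ hn
      have b := hTh _ hn
      have c := hThh _ hn
      rw [e1, e2] at a b c
      rw [a, b, c]
      push_cast
      rw [h1, h2, h3]
      refine ⟨?_, ?_, ?_⟩ <;> ring
  intro k hk
  obtain ⟨j, rfl⟩ : ∃ j, k = j + 1 := ⟨k - 1, by omega⟩
  exact (key j).2.2
end

section
/- Let T, Th, Thh : ℕ → ℕ satisfy T(1)=0, Th(1)=1, Thh(1)=3, and for all n ≥ 2: T(n)=T(⌈n/2⌉)+T(⌊n/2⌋)+2·Th(⌈n/2⌉)+2·Th(⌊n/2⌋)+1, Th(n)=T(⌈n/2⌉)+Th(⌊n/2⌋)+2·Th(⌈n/2⌉)+2·Thh(⌊n/2⌋)+1, Thh(n)=Th(⌈n/2⌉)+Th(⌊n/2⌋)+2·Thh(⌈n/2⌉)+2·Thh(⌊n/2⌋)+1. Then for every natural number k ≥ 0, 5·(T(2^k) + 4·Th(2^k) + 4·Thh(2^k)) = 89·6^k − 9. -/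
theorem fsr_eigen_six (T Th Thh : ℕ → ℕ)
    (hT1 : T 1 = 0) (hTh1 : Th 1 = 1) (hThh1 : Thh 1 = 3)
    (hT : ∀ n : ℕ, 2 ≤ n →
      T n = T ((n + 1) / 2) + T (n / 2) + 2 * Th ((n + 1) / 2) + 2 * Th (n / 2) + 1)
    (hTh : ∀ n : ℕ, 2 ≤ n →
      Th n = T ((n + 1) / 2) + Th (n / 2) + 2 * Th ((n + 1) / 2) + 2 * Thh (n / 2) + 1)
    (hThh : ∀ n : ℕ, 2 ≤ n →
      Thh n = Th ((n + 1) / 2) + Th (n / 2) + 2 * Thh ((n + 1) / 2) + 2 * Thh (n / 2) + 1) :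
    ∀ k : ℕ, 5 * (T (2 ^ k) + 4 * Th (2 ^ k) + 4 * Thh (2 ^ k)) = 89 * 6 ^ k - 9 := by
  intro k
  induction k with
  | zero => simp [hT1, hTh1, hThh1]
  | succ k ih =>
    have hp : 1 ≤ 2 ^ k := Nat.one_le_two_pow
    have h6 : 1 ≤ 6 ^ k := Nat.one_le_pow _ _ (by norm_num)
    have e : 2 ^ (k + 1) = 2 * 2 ^ k := by ring
    have e6 : 6 ^ (k + 1) = 6 * 6 ^ k := by ring
    have a := hT (2 * 2 ^ k) (by omega)
    have b := hTh (2 * 2 ^ k) (by omega)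
    have c := hThh (2 * 2 ^ k) (by omega)
    have d1 : (2 * 2 ^ k + 1) / 2 = 2 ^ k := by omega
    have d2 : 2 * 2 ^ k / 2 = 2 ^ k := by omega
    rw [d1, d2] at a b c
    rw [e, e6, a, b, c]
    omega
end

section
/- Let T, Th, Thh : ℕ → ℕ satisfy T(1)=0, Th(1)=1, Thh(1)=3, and for all n ≥ 2: T(n)=T(⌈n/2⌉)+T(⌊n/2⌋)+2·Th(⌈n/2⌉)+2·Th(⌊n/2⌋)+1, Th(n)=T(⌈n/2⌉)+Th(⌊n/2⌋)+2·Th(⌈n/2⌉)+2·Thh(⌊n/2⌋)+1, Thh(n)=Th(⌈n/2⌉)+Th(⌊n/2⌋)+2·Thh(⌈n/2⌉)+2·Thh(⌊n/2⌋)+1. Then for every natural number k ≥ 0, (T(2^k) : ℤ) + Th(2^k) − 2·Thh(2^k) = −5·3^k. -/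
theorem fsr_eigen_three (T Th Thh : ℕ → ℕ)
    (hT1 : T 1 = 0) (hTh1 : Th 1 = 1) (hThh1 : Thh 1 = 3)
    (hT : ∀ n : ℕ, 2 ≤ n →
      T n = T ((n + 1) / 2) + T (n / 2) + 2 * Th ((n + 1) / 2) + 2 * Th (n / 2) + 1)
    (hTh : ∀ n : ℕ, 2 ≤ n →
      Th n = T ((n + 1) / 2) + Th (n / 2) + 2 * Th ((n + 1) / 2) + 2 * Thh (n / 2) + 1)
    (hThh : ∀ n : ℕ, 2 ≤ n →
      Thh n = Th ((n + 1) / 2) + Th (n / 2) + 2 * Thh ((n + 1) / 2) + 2 * Thh (n / 2) + 1) :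
    ∀ k : ℕ, (T (2 ^ k) : ℤ) + Th (2 ^ k) - 2 * Thh (2 ^ k) = -5 * 3 ^ k := by
  intro k
  induction k with
  | zero => simp [hT1, hTh1, hThh1]
  | succ k ih =>
    have hpos : 1 ≤ 2 ^ k := Nat.one_le_two_pow
    have hp : 2 ^ (k + 1) = 2 * 2 ^ k := pow_succ' 2 k
    have h2 : 2 ≤ 2 ^ (k + 1) := by omega
    have e1 : (2 ^ (k + 1) + 1) / 2 = 2 ^ k := by omega
    have e2 : 2 ^ (k + 1) / 2 = 2 ^ k := by omega
    have a := hT _ h2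
    have b := hTh _ h2
    have c := hThh _ h2
    rw [e1, e2] at a b c
    rw [a, b, c, pow_succ]
    push_cast
    linarith
end

section
/- Let T, Th, Thh : ℕ → ℕ satisfy T(1)=0, Th(1)=1, Thh(1)=3, and for all n ≥ 2: T(n)=T(⌈n/2⌉)+T(⌊n/2⌋)+2·Th(⌈n/2⌉)+2·Th(⌊n/2⌋)+1, Th(n)=T(⌈n/2⌉)+Th(⌊n/2⌋)+2·Th(⌈n/2⌉)+2·Thh(⌊n/2⌋)+1, Thh(n)=Th(⌈n/2⌉)+Th(⌊n/2⌋)+2·Thh(⌈n/2⌉)+2·Thh(⌊n/2⌋)+1. Then the sequence k ↦ (T(2^k) : ℝ)/6^k converges, and its limit is 89/45. -/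
theorem fsr_leading_coeff (T Th Thh : ℕ → ℕ)
    (hT1 : T 1 = 0) (hTh1 : Th 1 = 1) (hThh1 : Thh 1 = 3)
    (hT : ∀ n : ℕ, 2 ≤ n →
      T n = T ((n + 1) / 2) + T (n / 2) + 2 * Th ((n + 1) / 2) + 2 * Th (n / 2) + 1)
    (hTh : ∀ n : ℕ, 2 ≤ n →
      Th n = T ((n + 1) / 2) + Th (n / 2) + 2 * Th ((n + 1) / 2) + 2 * Thh (n / 2) + 1)
    (hThh : ∀ n : ℕ, 2 ≤ n →
      Thh n = Th ((n + 1) / 2) + Th (n / 2) + 2 * Thh ((n + 1) / 2) + 2 * Thh (n / 2) + 1) :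
    Filter.Tendsto (fun k : ℕ => (T (2 ^ k) : ℝ) / 6 ^ k) Filter.atTop
      (nhds (89 / 45)) := by
  have key : ∀ k : ℕ,
      (T (2 ^ (k + 1)) : ℝ) = 89 / 45 * 6 ^ (k + 1) - 20 / 9 * 3 ^ (k + 1) - 1 / 5 ∧
      (Th (2 ^ (k + 1)) : ℝ) = 89 / 45 * 6 ^ (k + 1) - 5 / 9 * 3 ^ (k + 1) - 1 / 5 ∧
      (Thh (2 ^ (k + 1)) : ℝ) = 89 / 45 * 6 ^ (k + 1) + 10 / 9 * 3 ^ (k + 1) - 1 / 5 := by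
    intro k
    induction k with
    | zero =>
      have h1 := hT 2 le_rfl
      have h2 := hTh 2 le_rfl
      have h3 := hThh 2 le_rfl
      norm_num [hT1, hTh1, hThh1] at h1 h2 h3
      norm_num [h1, h2, h3]
    | succ k ih =>
      obtain ⟨i1, i2, i3⟩ := ih
      have hpos : 1 ≤ 2 ^ (k + 1) := Nat.one_le_two_pow
      have e0 : 2 ^ (k + 1 + 1) = 2 * 2 ^ (k + 1) := by ring
      have e1 : (2 ^ (k + 1 + 1) + 1) / 2 = 2 ^ (k + 1) := by omega
      have e2 : 2 ^ (k + 1 + 1) / 2 = 2 ^ (k + 1) := by omega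
      have h1 := hT (2 ^ (k + 1 + 1)) (by omega)
      have h2 := hTh (2 ^ (k + 1 + 1)) (by omega)
      have h3 := hThh (2 ^ (k + 1 + 1)) (by omega)
      rw [e1, e2] at h1 h2 h3
      rw [h1, h2, h3]
      push_cast
      rw [i1, i2, i3]
      refine ⟨?_, ?_, ?_⟩ <;> ring
  rw [← Filter.tendsto_add_atTop_iff_nat 1]
  have l1 : Filter.Tendsto (fun k : ℕ => ((1 : ℝ) / 2) ^ (k + 1)) Filter.atTop (nhds 0) :=
    (tendsto_pow_atTop_nhds_zero_of_lt_one (by norm_num) (by norm_num)).comp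
      (Filter.tendsto_add_atTop_nat 1)
  have l2 : Filter.Tendsto (fun k : ℕ => ((1 : ℝ) / 6) ^ (k + 1)) Filter.atTop (nhds 0) :=
    (tendsto_pow_atTop_nhds_zero_of_lt_one (by norm_num) (by norm_num)).comp
      (Filter.tendsto_add_atTop_nat 1)
  have l3 := ((l1.const_mul (20 / 9)).const_sub (89 / 45)).sub (l2.const_mul (1 / 5))
  simp only [mul_zero, sub_zero] at l3
  refine l3.congr fun k => ?_
  rw [(key k).1]
  have e3 : (6 : ℝ) ^ (k + 1) = 2 ^ (k + 1) * 3 ^ (k + 1) := by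
    rw [← mul_pow]; norm_num
  rw [div_pow, div_pow, one_pow, e3]
  field_simp
end

section
/- Let T, Th, Thh : ℕ → ℕ satisfy T(1)=0, Th(1)=1, Thh(1)=3, and for all n ≥ 2: T(n)=T(⌈n/2⌉)+T(⌊n/2⌋)+2·Th(⌈n/2⌉)+2·Th(⌊n/2⌋)+1, Th(n)=T(⌈n/2⌉)+Th(⌊n/2⌋)+2·Th(⌈n/2⌉)+2·Thh(⌊n/2⌋)+1, Thh(n)=Th(⌈n/2⌉)+Th(⌊n/2⌋)+2·Thh(⌈n/2⌉)+2·Thh(⌊n/2⌋)+1. Then for every n ≥ 1, T(n) ≤ Th(n) and Th(n) ≤ Thh(n). -/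
theorem fsr_monotone_in_leaves (T Th Thh : ℕ → ℕ)
    (hT1 : T 1 = 0) (hTh1 : Th 1 = 1) (hThh1 : Thh 1 = 3)
    (hT : ∀ n : ℕ, 2 ≤ n →
      T n = T ((n + 1) / 2) + T (n / 2) + 2 * Th ((n + 1) / 2) + 2 * Th (n / 2) + 1)
    (hTh : ∀ n : ℕ, 2 ≤ n →
      Th n = T ((n + 1) / 2) + Th (n / 2) + 2 * Th ((n + 1) / 2) + 2 * Thh (n / 2) + 1)
    (hThh : ∀ n : ℕ, 2 ≤ n →
      Thh n = Th ((n + 1) / 2) + Th (n / 2) + 2 * Thh ((n + 1) / 2) + 2 * Thh (n / 2) + 1) :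
    ∀ n : ℕ, 1 ≤ n → T n ≤ Th n ∧ Th n ≤ Thh n := by
  intro n
  induction n using Nat.strong_induction_on with
  | _ n ih =>
    intro hn
    by_cases h : 2 ≤ n
    · have h1 := ih ((n + 1) / 2) (by omega) (by omega)
      have h2 := ih (n / 2) (by omega) (by omega)
      have e1 := hT n h
      have e2 := hTh n h
      have e3 := hThh n h
      constructor <;> linarith [h1.1, h1.2, h2.1, h2.2]
    · have h1 : n = 1 := by omega
      subst h1
      omega
end

section
/- Let T, Th, Thh : ℕ → ℕ satisfy T(1)=0, Th(1)=1, Thh(1)=3, and for all n ≥ 2: T(n)=T(⌈n/2⌉)+T(⌊n/2⌋)+2·Th(⌈n/2⌉)+2·Th(⌊n/2⌋)+1, Th(n)=T(⌈n/2⌉)+Th(⌊n/2⌋)+2·Th(⌈n/2⌉)+2·Thh(⌊n/2⌋)+1, Thh(n)=Th(⌈n/2⌉)+Th(⌊n/2⌋)+2·Thh(⌈n/2⌉)+2·Thh(⌊n/2⌋)+1. Then there exists a constant C > 0 such that for every n ≥ 1, (T(n) : ℝ) ≤ C · (n : ℝ)^(log₂ 6). -/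
theorem fsr_2vdm_big_O (T Th Thh : ℕ → ℕ)
    (hT1 : T 1 = 0) (hTh1 : Th 1 = 1) (hThh1 : Thh 1 = 3)
    (hT : ∀ n : ℕ, 2 ≤ n →
      T n = T ((n + 1) / 2) + T (n / 2) + 2 * Th ((n + 1) / 2) + 2 * Th (n / 2) + 1)
    (hTh : ∀ n : ℕ, 2 ≤ n →
      Th n = T ((n + 1) / 2) + Th (n / 2) + 2 * Th ((n + 1) / 2) + 2 * Thh (n / 2) + 1)
    (hThh : ∀ n : ℕ, 2 ≤ n →
      Thh n = Th ((n + 1) / 2) + Th (n / 2) + 2 * Thh ((n + 1) / 2) + 2 * Thh (n / 2) + 1) :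
    ∃ C : ℝ, 0 < C ∧ ∀ n : ℕ, 1 ≤ n →
      (T n : ℝ) ≤ C * (n : ℝ) ^ (Real.logb 2 6) := by
  have key : ∀ k n : ℕ, 1 ≤ n → n ≤ 2 ^ k →
      T n + 1 ≤ 4 * 6 ^ k ∧ Th n + 1 ≤ 4 * 6 ^ k ∧ Thh n + 1 ≤ 4 * 6 ^ k := by
    intro k
    induction k with
    | zero =>
      intro n h1 h2
      have : n = 1 := by simp at h2; omega
      subst this
      simp [hT1, hTh1, hThh1]
    | succ k ih =>
      intro n h1 h2
      have h6 : 1 ≤ 6 ^ k := Nat.one_le_pow _ _ (by norm_num)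
      rw [pow_succ] at h2 ⊢
      by_cases hn : n = 1
      · subst hn
        rw [hT1, hTh1, hThh1]
        omega
      · have hn2 : 2 ≤ n := by omega
        obtain ⟨a1, a2, a3⟩ := ih ((n + 1) / 2) (by omega) (by omega)
        obtain ⟨b1, b2, b3⟩ := ih (n / 2) (by omega) (by omega)
        rw [hT n hn2, hTh n hn2, hThh n hn2]
        omega
  refine ⟨24, by norm_num, fun n hn => ?_⟩
  have h1 := (key (Nat.log 2 n + 1) n hn (Nat.lt_pow_succ_log_self (by norm_num) n).le).1
  have h2 : 2 ^ Nat.log 2 n ≤ n := Nat.pow_log_le_self 2 (by omega)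
  have h3 : ((2 : ℝ) ^ Nat.log 2 n) ≤ n := by exact_mod_cast h2
  have hl : 0 ≤ Real.logb 2 6 := Real.logb_nonneg (by norm_num) (by norm_num)
  have h4 := Real.rpow_le_rpow (by positivity) h3 hl
  have h5 : ((2 : ℝ) ^ Nat.log 2 n) ^ Real.logb 2 6 = 6 ^ Nat.log 2 n := by
    rw [← Real.rpow_natCast, ← Real.rpow_mul (by norm_num), mul_comm,
      Real.rpow_mul (by norm_num), Real.rpow_logb (by norm_num) (by norm_num) (by norm_num),
      Real.rpow_natCast]
  rw [h5] at h4
  have h6 : (T n : ℝ) + 1 ≤ 4 * 6 ^ (Nat.log 2 n + 1) := by exact_mod_cast h1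
  rw [pow_succ] at h6
  linarith
end

section
/- Let T, Th, Thh : ℕ → ℕ satisfy T(1)=0, Th(1)=1, Thh(1)=3, and for all n ≥ 2: T(n)=T(⌈n/2⌉)+T(⌊n/2⌋)+2·Th(⌈n/2⌉)+2·Th(⌊n/2⌋)+1, Th(n)=T(⌈n/2⌉)+Th(⌊n/2⌋)+2·Th(⌈n/2⌉)+2·Thh(⌊n/2⌋)+1, Thh(n)=Th(⌈n/2⌉)+Th(⌊n/2⌋)+2·Thh(⌈n/2⌉)+2·Thh(⌊n/2⌋)+1. Then for every integer k ≥ 2, T(2^k) ≥ 6^k. -/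
theorem fsr_lower_bound (T Th Thh : ℕ → ℕ)
    (hT1 : T 1 = 0) (hTh1 : Th 1 = 1) (hThh1 : Thh 1 = 3)
    (hT : ∀ n : ℕ, 2 ≤ n →
      T n = T ((n + 1) / 2) + T (n / 2) + 2 * Th ((n + 1) / 2) + 2 * Th (n / 2) + 1)
    (hTh : ∀ n : ℕ, 2 ≤ n →
      Th n = T ((n + 1) / 2) + Th (n / 2) + 2 * Th ((n + 1) / 2) + 2 * Thh (n / 2) + 1)
    (hThh : ∀ n : ℕ, 2 ≤ n →
      Thh n = Th ((n + 1) / 2) + Th (n / 2) + 2 * Thh ((n + 1) / 2) + 2 * Thh (n / 2) + 1) :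
    ∀ k : ℕ, 2 ≤ k → 6 ^ k ≤ T (2 ^ k) := by
  have step : ∀ k : ℕ, T (2 ^ (k + 1)) = 2 * T (2 ^ k) + 4 * Th (2 ^ k) + 1 ∧
      Th (2 ^ (k + 1)) = T (2 ^ k) + 3 * Th (2 ^ k) + 2 * Thh (2 ^ k) + 1 ∧
      Thh (2 ^ (k + 1)) = 2 * Th (2 ^ k) + 4 * Thh (2 ^ k) + 1 := by
    intro k
    have hp : 1 ≤ 2 ^ k := Nat.one_le_two_pow
    have h2 : 2 ≤ 2 ^ (k + 1) := by rw [pow_succ]; omega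
    have e1 : (2 ^ (k + 1) + 1) / 2 = 2 ^ k := by rw [pow_succ]; omega
    have e2 : 2 ^ (k + 1) / 2 = 2 ^ k := by rw [pow_succ]; omega
    have a := hT _ h2
    have b := hTh _ h2
    have c := hThh _ h2
    rw [e1, e2] at a b c
    refine ⟨?_, ?_, ?_⟩ <;> omega
  have key : ∀ k : ℕ, 2 ≤ k →
      6 ^ k ≤ T (2 ^ k) ∧ 6 ^ k ≤ Th (2 ^ k) ∧ 6 ^ k ≤ Thh (2 ^ k) := by
    intro k hk
    induction k, hk using Nat.le_induction with
    | base =>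
      have s0 := step 0
      have s1 := step 1
      norm_num at s0 s1 ⊢
      omega
    | succ k hk ih =>
      have s := step k
      rw [pow_succ 6 k]
      omega
  exact fun k hk => (key k hk).1
end
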